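/- arXiv:1704.08934 — 2 statements merged into one kernel-verified Lean document; each statement's English description precedes it below -/
import Mathlib

section
/- Let φ(z) be a CNF formula on variables z and let g₁, g₂, h be literals on z with var(g₁) ≠ var(h). If the formula φ[g₁←g₂] is satisfiable, then φ ⊢₁ h implies φ[g₁←g₂] ⊢₁ h. -/
/-- A literal is a variable together with a polarity (`true` = positive). -/
abbrev Lit (V : Type) := V × Bool

/-- The negation of a literal. -/
def negLit {V : Type} (l : Lit V) : Lit V := (l.1, !l.2)

/-- A clause is a finite set of literals. -/
abbrev Clause (V : Type) := Finset (Lit V)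

/-- A CNF formula is a finite set of clauses. -/
abbrev CNF (V : Type) := Finset (Clause V)

/-- A clause proper contains no complementary pair of literals. -/
def IsClause {V : Type} [DecidableEq V] (C : Clause V) : Prop := ∀ l ∈ C, negLit l ∉ C

instance {V : Type} [DecidableEq V] (C : Clause V) : Decidable (IsClause C) := by
  unfold IsClause; infer_instance

/-- A CNF formula proper consists of proper clauses. -/
def IsCNF {V : Type} [DecidableEq V] (φ : CNF V) : Prop := ∀ C ∈ φ, IsClause C

/-- Satisfaction of a literal by an assignment. -/
def LitSat {V : Type} (α : V → Bool) (l : Lit V) : Prop := α l.1 = l.2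

/-- Satisfaction of a clause by an assignment. -/
def ClauseSat {V : Type} (α : V → Bool) (C : Clause V) : Prop := ∃ l ∈ C, LitSat α l

/-- Satisfaction of a CNF formula by an assignment. -/
def CnfSat {V : Type} (α : V → Bool) (φ : CNF V) : Prop := ∀ C ∈ φ, ClauseSat α C

/-- `UnitDerives φ C` : the clause `C` can be derived from `φ` by a series of unit
resolutions (each step resolves a derived unit clause with another derived clause). -/
inductive UnitDerives {V : Type} [DecidableEq V] (φ : CNF V) : Clause V → Prop
  | base {C : Clause V} (h : C ∈ φ) : UnitDerives φ C
  | step {l : Lit V} {C : Clause V} (h1 : UnitDerives φ {l})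
      (h2 : UnitDerives φ C) (h3 : negLit l ∈ C) :
      UnitDerives φ (C.erase (negLit l))

/-- The formula `φ ∧ l` (adding a unit clause). -/
def addUnit {V : Type} [DecidableEq V] (φ : CNF V) (l : Lit V) : CNF V :=
  insert {l} φ

/-- The formula `φ ∧ g₁ ∧ … ∧ g_p` (adding finitely many unit clauses). -/
def addUnits {V : Type} [DecidableEq V] (φ : CNF V) (L : Finset (Lit V)) : CNF V :=
  φ ∪ L.image (fun l => ({l} : Clause V))

/-- Variables: `n` input variables and `ℓ` auxiliary variables. -/
abbrev Var (n ℓ : ℕ) : Type := Sum (Fin n) (Fin ℓ)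

/-- The literal on the `i`-th input variable with polarity `b`. -/
def inLit {n ℓ : ℕ} (i : Fin n) (b : Bool) : Lit (Var n ℓ) := (Sum.inl i, b)

/-- A p-encoding: (P1) `φ ∧ x_i` is satisfiable for each input variable `x_i`, and
(P2) `φ ∧ x_i ⊢₁ ¬x_j` for all `i ≠ j`. -/
def IsPEncoding {n ℓ : ℕ} (φ : CNF (Var n ℓ)) : Prop :=
  IsCNF φ ∧
  (∀ i : Fin n, ∃ α : Var n ℓ → Bool, CnfSat α φ ∧ α (Sum.inl i) = true) ∧
  (∀ i j : Fin n, i ≠ j →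
    UnitDerives (addUnit φ (inLit i true)) {inLit j false})

/-- A p-encoding relative to a set `I` of input indices. -/
def IsPEncodingOn {n ℓ : ℕ} (φ : CNF (Var n ℓ)) (I : Finset (Fin n)) : Prop :=
  IsCNF φ ∧
  (∀ i ∈ I, ∃ α : Var n ℓ → Bool, CnfSat α φ ∧ α (Sum.inl i) = true) ∧
  (∀ i ∈ I, ∀ j ∈ I, i ≠ j →
    UnitDerives (addUnit φ (inLit i true)) {inLit j false})

/-- 2-CNF: every clause has at most two literals. -/
def Is2CNF {V : Type} (φ : CNF V) : Prop := ∀ C ∈ φ, C.card ≤ 2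

/-- The set of possible sizes of p-encodings with `n` input variables. -/
def pencSizes (n : ℕ) : Set ℕ :=
  {k | ∃ ℓ : ℕ, ∃ φ : CNF (Var n ℓ), IsPEncoding φ ∧ φ.card = k}

/-- `S n` : the minimum size of a p-encoding with `n` input variables. -/
noncomputable def S (n : ℕ) : ℕ := sInf (pencSizes n)

/-- The set of possible sizes of 2-CNF p-encodings with `n` input variables. -/
def penc2Sizes (n : ℕ) : Set ℕ :=
  {k | ∃ ℓ : ℕ, ∃ φ : CNF (Var n ℓ), IsPEncoding φ ∧ Is2CNF φ ∧ φ.card = k}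

/-- `S₂ n` : the minimum size of a 2-CNF p-encoding with `n` input variables. -/
noncomputable def S2 (n : ℕ) : ℕ := sInf (penc2Sizes n)

/-- `φ(x,y)` is an encoding of the boolean function `f(x)`. -/
def Encodes {n ℓ : ℕ} (φ : CNF (Var n ℓ)) (f : (Fin n → Bool) → Prop) : Prop :=
  IsCNF φ ∧
  ∀ α : Fin n → Bool, f α ↔ ∃ β : Fin ℓ → Bool, CnfSat (Sum.elim α β) φ

/-- Injection of literals on input variables into literals of the encoding. -/
def inLits {n ℓ : ℕ} (G : Finset (Lit (Fin n))) : Finset (Lit (Var n ℓ)) :=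
  G.image (fun g => ((Sum.inl g.1 : Var n ℓ), g.2))

/-- Propagation complete encoding of `f`: an encoding such that whenever
`f ∧ g₁ ∧ … ∧ g_p ⊨ h` for literals on input variables (`p ≥ 1`), unit propagation
from `φ ∧ g₁ ∧ … ∧ g_p` derives `h` or derives the empty clause. -/
def IsPCEncoding {n ℓ : ℕ} (φ : CNF (Var n ℓ)) (f : (Fin n → Bool) → Prop) : Prop :=
  Encodes φ f ∧
  ∀ G : Finset (Lit (Fin n)), G.Nonempty → ∀ h : Lit (Fin n),
    (∀ α : Fin n → Bool, f α → (∀ g ∈ G, α g.1 = g.2) → α h.1 = h.2) →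
    (UnitDerives (addUnits φ (inLits G)) {((Sum.inl h.1 : Var n ℓ), h.2)} ∨
     UnitDerives (addUnits φ (inLits G)) (∅ : Clause (Var n ℓ)))

/-- The "at most one" function. -/
def AMO (n : ℕ) (α : Fin n → Bool) : Prop :=
  (Finset.univ.filter fun i => α i = true).card ≤ 1

/-- The "exactly one" function. -/
def EXO (n : ℕ) (α : Fin n → Bool) : Prop :=
  (Finset.univ.filter fun i => α i = true).card = 1

/-- `Qset φ i` : the set of clauses of `φ` containing the literal `¬x_i`. -/
def Qset {n ℓ : ℕ} (φ : CNF (Var n ℓ)) (i : Fin n) : CNF (Var n ℓ) :=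
  φ.filter (fun C => inLit i false ∈ C)

/-- Regular form: for each `i`, `|Q_i| = 2`, clauses of `Q_i` contain no input variables
other than `x_i`, and all clauses of `Q_i` are binary. -/
def RegularForm {n ℓ : ℕ} (φ : CNF (Var n ℓ)) : Prop :=
  ∀ i : Fin n,
    (Qset φ i).card = 2 ∧
    (∀ C ∈ Qset φ i, ∀ j : Fin n, ∀ b : Bool, ((Sum.inl j : Var n ℓ), b) ∈ C → j = i) ∧
    (∀ C ∈ Qset φ i, C.card = 2)

/-- `C` is an implicate of `φ`. -/
def Implicate {V : Type} (φ : CNF V) (C : Clause V) : Prop :=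
  ∀ α : V → Bool, CnfSat α φ → ClauseSat α C

/-- `C` is a prime implicate of `φ`. -/
def PrimeImplicate {V : Type} (φ : CNF V) (C : Clause V) : Prop :=
  Implicate φ C ∧ ∀ C' : Clause V, C' ⊂ C → ¬ Implicate φ C'

/-- `φ` is prime: every clause of `φ` is a prime implicate of `φ`. -/
def IsPrime {V : Type} (φ : CNF V) : Prop := ∀ C ∈ φ, PrimeImplicate φ C

/-- The set of clauses of `φ` in which the auxiliary variable `y` occurs
(as a positive or negative literal). -/
def occursIn {n ℓ : ℕ} (φ : CNF (Var n ℓ)) (y : Fin ℓ) : CNF (Var n ℓ) :=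
  φ.filter (fun C => ((Sum.inr y : Var n ℓ), true) ∈ C ∨ ((Sum.inr y : Var n ℓ), false) ∈ C)

/-- The substitution `g₁ ← g₂` on a literal: `g₁ ↦ g₂`, `¬g₁ ↦ ¬g₂`,
all other literals unchanged. -/
def substLit {V : Type} [DecidableEq V] (g₁ g₂ : Lit V) (l : Lit V) : Lit V :=
  if l.1 = g₁.1 then (if l.2 = g₁.2 then g₂ else negLit g₂) else l

/-- The substitution `g₁ ← g₂` applied to a clause. -/
def substClause {V : Type} [DecidableEq V] (g₁ g₂ : Lit V) (C : Clause V) : Clause V :=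
  C.image (substLit g₁ g₂)

/-- The formula `φ[g₁ ← g₂]`: apply the substitution to every clause and remove the
clauses that became tautological (i.e. contain a complementary pair of literals). -/
def substCNF {V : Type} [DecidableEq V] (g₁ g₂ : Lit V) (φ : CNF V) : CNF V :=
  (φ.image (substClause g₁ g₂)).filter (fun C => IsClause C)

/-- `restrict φ ρ` : the formula `φ(ρ)` obtained from `φ` by the partial assignment
given by the set of literals `ρ` (clauses satisfied by `ρ` are removed, and falsified
literals are removed from the remaining clauses). -/
def restrict {V : Type} [DecidableEq V] (φ : CNF V) (ρ : Finset (Lit V)) : CNF V :=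
  (φ.filter (fun C => ∀ l ∈ ρ, l ∉ C)).image (fun C => C.filter (fun l => negLit l ∉ ρ))

theorem negLit_negLit {V : Type} (l : Lit V) : negLit (negLit l) = l := by
  simp [negLit]

theorem negLit_ne {V : Type} (l : Lit V) : negLit l ≠ l := by
  simp [negLit, Prod.ext_iff]

theorem substLit_negLit {V : Type} [DecidableEq V] (g₁ g₂ l : Lit V) :
    substLit g₁ g₂ (negLit l) = negLit (substLit g₁ g₂ l) := by
  obtain ⟨v, b⟩ := l
  obtain ⟨w, c⟩ := g₁
  by_cases hv : v = w
  · cases b <;> cases c <;> simp [substLit, negLit, hv]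
  · simp [substLit, negLit, hv]

/-- Unit resolution is sound. -/
theorem UnitDerives.clauseSat {V : Type} [DecidableEq V] {φ : CNF V} {C : Clause V}
    (hC : UnitDerives φ C) {α : V → Bool} (hα : CnfSat α φ) : ClauseSat α C := by
  induction hC with
  | base h => exact hα _ h
  | step _ _ _ ih1 ih2 =>
    obtain ⟨l', hl', hs'⟩ := ih1
    obtain ⟨m, hm, hs⟩ := ih2
    rw [Finset.mem_singleton] at hl'
    subst hl'
    refine ⟨m, Finset.mem_erase.2 ⟨?_, hm⟩, hs⟩
    rintro rfl
    simp_all [LitSat, negLit]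

/-- A satisfiable formula deriving a subclause of a unit clause derives that unit clause. -/
theorem UnitDerives.singleton_of_subset {V : Type} [DecidableEq V] {φ : CNF V} {D : Clause V}
    (hD : UnitDerives φ D) (hsat : ∃ α : V → Bool, CnfSat α φ) {l : Lit V} (hl : D ⊆ {l}) :
    UnitDerives φ {l} := by
  obtain ⟨α, hα⟩ := hsat
  obtain ⟨m, hm, -⟩ := hD.clauseSat hα
  rcases Finset.subset_singleton_iff.1 hl with rfl | rfl
  · simp at hm
  · exact hD

theorem isClause_singleton {V : Type} [DecidableEq V] (l : Lit V) :
    IsClause ({l} : Clause V) := by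
  intro m hm
  rw [Finset.mem_singleton] at hm ⊢
  subst hm
  exact negLit_ne m

theorem substClause_singleton {V : Type} [DecidableEq V] (g₁ g₂ l : Lit V) :
    substClause g₁ g₂ {l} = {substLit g₁ g₂ l} :=
  Finset.image_singleton _ _

/-- Substituting into a derived clause yields a tautology or a clause subsumed by one
derivable from the substituted formula. -/
theorem UnitDerives.exists_subset_substClause {V : Type} [DecidableEq V] {φ : CNF V}
    {g₁ g₂ : Lit V} (hsat : ∃ α : V → Bool, CnfSat α (substCNF g₁ g₂ φ)) {C : Clause V}
    (hC : UnitDerives φ C) (hcl : IsClause (substClause g₁ g₂ C)) :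
    ∃ D ⊆ substClause g₁ g₂ C, UnitDerives (substCNF g₁ g₂ φ) D := by
  induction hC with
  | base h =>
    exact ⟨_, subset_rfl, .base (Finset.mem_filter.2 ⟨Finset.mem_image_of_mem _ h, hcl⟩)⟩
  | @step l C _ _ _ ih1 ih2 =>
    rw [substClause_singleton] at ih1
    obtain ⟨D₁, hD₁, hd₁⟩ := ih1 (isClause_singleton _)
    have hl := hd₁.singleton_of_subset hsat hD₁
    have hmem : ∀ m ∈ substClause g₁ g₂ C, m ≠ negLit (substLit g₁ g₂ l) →
        m ∈ substClause g₁ g₂ (C.erase (negLit l)) := by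
      intro m hm hne
      obtain ⟨x, hx, rfl⟩ := Finset.mem_image.1 hm
      refine Finset.mem_image_of_mem _ (Finset.mem_erase.2 ⟨?_, hx⟩)
      rintro rfl
      exact hne (substLit_negLit _ _ _)
    by_cases hl' : substLit g₁ g₂ l ∈ substClause g₁ g₂ C
    · exact ⟨_, Finset.singleton_subset_iff.2 (hmem _ hl' (negLit_ne _).symm), hl⟩
    · have hclC : IsClause (substClause g₁ g₂ C) := by
        intro m hm hnm
        refine hcl m (hmem m hm ?_) (hmem _ hnm ?_)
        · rintro rfl
          rw [negLit_negLit] at hnm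
          exact hl' hnm
        · intro he
          have := congrArg negLit he
          rw [negLit_negLit, negLit_negLit] at this
          exact hl' (this ▸ hm)
      obtain ⟨D₂, hD₂, hd₂⟩ := ih2 hclC
      by_cases hn : negLit (substLit g₁ g₂ l) ∈ D₂
      · refine ⟨_, fun m hm => ?_, .step hl hd₂ hn⟩
        rw [Finset.mem_erase] at hm
        exact hmem m (hD₂ hm.2) hm.1
      · exact ⟨D₂, fun m hm => hmem m (hD₂ hm) (fun he => hn (he ▸ hm)), hd₂⟩

/-- Let φ be a CNF formula on variables z and g₁, g₂, h literals on z
with var(g₁) ≠ var(h). If φ[g₁←g₂] is satisfiable, then φ ⊢₁ h implies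
φ[g₁←g₂] ⊢₁ h. -/
theorem substitution_preserves_unit_propagation {V : Type} [DecidableEq V]
    (φ : CNF V) (hcnf : IsCNF φ) (g₁ g₂ h : Lit V) (hvar : g₁.1 ≠ h.1)
    (hsat : ∃ α : V → Bool, CnfSat α (substCNF g₁ g₂ φ)) :
    UnitDerives φ {h} → UnitDerives (substCNF g₁ g₂ φ) {h} := by
  intro hd
  have hh : substClause g₁ g₂ {h} = {h} := by
    rw [substClause_singleton, substLit, if_neg hvar.symm]
  obtain ⟨D, hD, hDd⟩ := hd.exists_subset_substClause hsat (by
    rw [hh]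
    exact isClause_singleton h)
  exact hDd.singleton_of_subset hsat (hD.trans hh.subset)
end

section
/- Let φ(x,y) be a p-encoding with n ≥ 7 input variables x=(x_1,…,x_n) that is in regular form. Then |φ| ≥ 2n + √(n − 3/4) − 3/2. -/
section Pairs

variable {ι Λ : Type*} [DecidableEq ι] [DecidableEq Λ] {neg : Λ → Λ} {D : ι → Finset Λ} {r : ℕ}

/-- A degree bound: few pairs `{u, o i}`, `i ∈ I`, can share the literal `u`. -/
theorem card_star_le {I : Finset ι} {u : Λ} {o : ι → Λ}
    (hneg : Function.Involutive neg) (hcard : ∀ i, (D i).card ≤ r + 2)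
    (hcons : ∀ i, ∀ z ∈ D i, neg z ∉ D i)
    (hu : ∀ i ∈ I, neg u ∈ D i) (ho : ∀ i ∈ I, neg (o i) ∈ D i)
    (hcov : ∀ i ∈ I, ∀ j ∈ I, i ≠ j → u ∈ D i ∨ o j ∈ D i) (hne : ∀ i ∈ I, u ≠ o i) :
    I.card ≤ max 2 (r + 1) := by
  have hoD : ∀ i ∈ I, ∀ j ∈ I, i ≠ j → o j ∈ D i := fun i hi j hj hij =>
    (hcov i hi j hj hij).resolve_left fun h => hcons i u h (hu i hi)
  have hinj : ∀ i ∈ I, ∀ j ∈ I, o i = o j → i = j := by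
    intro i hi j hj h
    by_contra hij
    exact hcons i _ (hoD i hi j hj hij) (h ▸ ho i hi)
  have hsub : ∀ i ∈ I, (I.erase i).image o ⊆ (D i).erase (neg u) := by
    intro i hi z hz
    obtain ⟨j, hj, rfl⟩ := Finset.mem_image.1 hz
    obtain ⟨hji, hj⟩ := Finset.mem_erase.1 hj
    refine Finset.mem_erase.2 ⟨fun h => ?_, hoD i hi j hj (Ne.symm hji)⟩
    exact hcons j _ (hu j hj) (h ▸ ho j hj)
  have himg : ∀ i ∈ I, ((I.erase i).image o).card = I.card - 1 := by
    intro i hi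
    rw [Finset.card_image_of_injOn, Finset.card_erase_of_mem hi]
    intro a ha b hb h
    exact hinj a (Finset.mem_of_mem_erase ha) b (Finset.mem_of_mem_erase hb) h
  have herase : ∀ i ∈ I, ((D i).erase (neg u)).card ≤ r + 1 := by
    intro i hi
    rw [Finset.card_erase_of_mem (hu i hi)]
    have := hcard i
    omega
  by_contra! hlt
  obtain ⟨h2, hr⟩ := max_lt_iff.1 hlt
  have hpartner : ∀ i ∈ I, ∃ k ∈ I, k ≠ i ∧ o k = neg (o i) := by
    intro i hi
    have heq := Finset.eq_of_subset_of_card_le (hsub i hi) (by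
      rw [himg i hi]
      have := herase i hi
      omega)
    have hmem : neg (o i) ∈ (D i).erase (neg u) :=
      Finset.mem_erase.2 ⟨fun h => hne i hi (hneg.injective h).symm, ho i hi⟩
    rw [← heq] at hmem
    obtain ⟨k, hk, hok⟩ := Finset.mem_image.1 hmem
    exact ⟨k, Finset.mem_of_mem_erase hk, Finset.ne_of_mem_erase hk, hok⟩
  obtain ⟨i, hi⟩ : I.Nonempty := Finset.card_pos.1 (by omega)
  obtain ⟨k, hk, hki, hok⟩ := hpartner i hi
  obtain ⟨m, hm, hmik⟩ : ∃ m ∈ I, m ∉ ({i, k} : Finset ι) :=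
    Finset.exists_mem_notMem_of_card_lt_card (Finset.card_le_two.trans_lt h2)
  simp only [Finset.mem_insert, Finset.mem_singleton, not_or] at hmik
  obtain ⟨k', hk', hkm, hok'⟩ := hpartner m hm
  have hk'i : k' ≠ i := by
    rintro rfl
    refine hmik.2 (hinj m hm k hk ?_)
    rw [hok, hok', hneg]
  exact hcons i _ (hoD i hi m hm (Ne.symm hmik.1)) (hok' ▸ hoD i hi k' hk' (Ne.symm hk'i))

/-- A bound on the number of pairs `{g i, h i}` of literals, each of which falsifies a consistent
set `D i` of at most `r + 2` literals that meets all the other pairs. -/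
theorem card_pairs_le [Fintype ι] {g h : ι → Λ}
    (hneg : Function.Involutive neg) (hcard : ∀ i, (D i).card ≤ r + 2)
    (hcons : ∀ i, ∀ z ∈ D i, neg z ∉ D i)
    (hg : ∀ i, neg (g i) ∈ D i) (hh : ∀ i, neg (h i) ∈ D i)
    (hcov : ∀ i j, i ≠ j → g j ∈ D i ∨ h j ∈ D i) (hne : ∀ i, g i ≠ h i) :
    Fintype.card ι ≤ (r + 2) * max 2 (r + 1) + 1 := by
  rcases isEmpty_or_nonempty ι with hι | ⟨⟨i⟩⟩
  · simp
  let I : Λ → Finset ι := fun u => Finset.univ.filter fun j => g j = u ∨ h j = u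
  have hI : ∀ u, (I u).card ≤ max 2 (r + 1) := by
    intro u
    refine card_star_le (u := u) (o := fun j => if g j = u then h j else g j)
      hneg hcard hcons ?_ ?_ ?_ ?_
    · intro j hj
      rcases (Finset.mem_filter.1 hj).2 with rfl | rfl
      exacts [hg j, hh j]
    · intro j _
      split_ifs
      exacts [hh j, hg j]
    · intro j _ k hk hjk
      have hk := (Finset.mem_filter.1 hk).2
      have := hcov j k hjk
      split_ifs with hgk
      · exact hgk ▸ this
      · exact (hk.resolve_left hgk) ▸ this.symm
    · intro j hj
      split_ifs with hgj
      · exact hgj ▸ hne j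
      · exact Ne.symm hgj
  have hsub : Finset.univ.erase i ⊆ (D i).biUnion I := by
    intro j hj
    rcases hcov i j (Ne.symm (Finset.ne_of_mem_erase hj)) with hd | hd
    · exact Finset.mem_biUnion.2 ⟨_, hd, by simp [I]⟩
    · exact Finset.mem_biUnion.2 ⟨_, hd, by simp [I]⟩
  have hle := (Finset.card_le_card hsub).trans
    (Finset.card_biUnion_le_card_mul (D i) I _ fun u _ => hI u)
  rw [Finset.card_erase_of_mem (Finset.mem_univ i), Finset.card_univ] at hle
  have := Nat.mul_le_mul_right (max 2 (r + 1)) (hcard i)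
  omega

end Pairs

theorem negLit_involutive {V : Type} : Function.Involutive (negLit (V := V)) := by
  rintro ⟨v, b⟩
  simp [negLit]

theorem litSat_negLit {V : Type} {α : V → Bool} {l : Lit V} :
    LitSat α (negLit l) ↔ ¬ LitSat α l := by
  simp only [LitSat, negLit]
  cases α l.1 <;> cases l.2 <;> simp

namespace UnitDerives

variable {V : Type} [DecidableEq V] {ψ : CNF V}

theorem clauseSat_s19 {C : Clause V} (h : UnitDerives ψ C) {α : V → Bool} (hα : CnfSat α ψ) :
    ClauseSat α C := by
  induction h with
  | base h => exact hα _ h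
  | @step l C _ _ _ ih1 ih2 =>
    obtain ⟨m, hm, hml⟩ := ih2
    obtain ⟨l', hl', hl⟩ := ih1
    rw [Finset.mem_singleton.1 hl'] at hl
    refine ⟨m, Finset.mem_erase.2 ⟨?_, hm⟩, hml⟩
    rintro rfl
    exact litSat_negLit.1 hml hl

theorem litSat {l : Lit V} (h : UnitDerives ψ {l}) {α : V → Bool} (hα : CnfSat α ψ) :
    LitSat α l := by
  simpa [ClauseSat] using h.clauseSat_s19 hα

theorem exists_source {C : Clause V} (h : UnitDerives ψ C) :
    ∃ B ∈ ψ, C ⊆ B ∧ ∀ l ∈ B, l ∉ C → UnitDerives ψ {negLit l} := by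
  induction h with
  | @base C h => exact ⟨C, h, subset_rfl, fun l hl hl' => absurd hl hl'⟩
  | @step l C h1 _ _ _ ih2 =>
    obtain ⟨B, hB, hCB, hrest⟩ := ih2
    refine ⟨B, hB, (Finset.erase_subset _ _).trans hCB, fun m hm hmC => ?_⟩
    by_cases hmem : m ∈ C
    · have : m = negLit l := by
        by_contra hne
        exact hmC (Finset.mem_erase.2 ⟨hne, hmem⟩)
      rw [this, negLit_involutive]
      exact h1
    · exact hrest m hm hmem

theorem exists_reason {l : Lit V} (h : UnitDerives ψ {l}) :
    ∃ B ∈ ψ, l ∈ B ∧ ∀ m ∈ B, m ≠ l → UnitDerives ψ {negLit m} := by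
  obtain ⟨B, hB, hl, hrest⟩ := h.exists_source
  exact ⟨B, hB, Finset.singleton_subset_iff.1 hl, fun m hm hml => hrest m hm (by simpa using hml)⟩

end UnitDerives

section Regular

variable {n ℓ : ℕ} {φ : CNF (Var n ℓ)}

/-- The clauses of `φ` without negative input literals. -/
def coreClauses (φ : CNF (Var n ℓ)) : CNF (Var n ℓ) :=
  φ.filter fun C => ∀ i : Fin n, inLit i false ∉ C

theorem card_eq_of_regularForm (hreg : RegularForm φ) :
    φ.card = 2 * n + (coreClauses φ).card := by
  have hsplit : φ = (Finset.univ.biUnion fun i => Qset φ i) ∪ coreClauses φ := by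
    ext C
    simp only [Finset.mem_union, Finset.mem_biUnion, Finset.mem_univ, true_and, Qset, coreClauses,
      Finset.mem_filter]
    by_cases h : ∃ i : Fin n, inLit i false ∈ C
    · obtain ⟨i, hi⟩ := h
      exact ⟨fun hC => Or.inl ⟨i, hC, hi⟩, by rintro (⟨_, hC, _⟩ | ⟨hC, _⟩) <;> exact hC⟩
    · push Not at h
      exact ⟨fun hC => Or.inr ⟨hC, h⟩, by rintro (⟨_, hC, _⟩ | ⟨hC, _⟩) <;> exact hC⟩
  conv_lhs => rw [hsplit]
  rw [Finset.card_union_of_disjoint, Finset.card_biUnion]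
  · simp [fun i => (hreg i).1, mul_comm]
  · intro i _ j _ hij
    refine Finset.disjoint_left.2 ?_
    intro C hi hj
    exact hij ((hreg j).2.1 C hj i false (Finset.mem_filter.1 hi).2)
  · rw [Finset.disjoint_left]
    intro C hC hC'
    obtain ⟨i, _, hi⟩ := Finset.mem_biUnion.1 hC
    exact (Finset.mem_filter.1 hC').2 i (Finset.mem_filter.1 hi).2

theorem exists_aux_of_mem_Qset (hcnf : IsCNF φ) (hreg : RegularForm φ) {i : Fin n}
    {C : Clause (Var n ℓ)} (hC : C ∈ Qset φ i) :
    ∃ g : Lit (Var n ℓ), g.1.isRight = true ∧ C = {inLit i false, g} := by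
  obtain ⟨hCφ, hi⟩ := Finset.mem_filter.1 hC
  obtain ⟨g, hg⟩ := Finset.card_eq_one.1
    (show (C.erase (inLit i false)).card = 1 by
      rw [Finset.card_erase_of_mem hi, (hreg i).2.2 C hC])
  have hgC := Finset.mem_erase.1 (hg ▸ Finset.mem_singleton_self g)
  refine ⟨g, ?_, by rw [← hg, Finset.insert_erase hi]⟩
  obtain ⟨v | y, b⟩ := g
  · exfalso
    obtain rfl := (hreg i).2.1 C hC v b hgC.2
    cases b
    · exact hgC.1 rfl
    · exact hcnf C hCφ _ hi hgC.2
  · rfl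

theorem exists_aux_pair (hcnf : IsCNF φ) (hreg : RegularForm φ) (i : Fin n) :
    ∃ g h : Lit (Var n ℓ), g.1.isRight = true ∧ h.1.isRight = true ∧ g ≠ h ∧
      Qset φ i = {{inLit i false, g}, {inLit i false, h}} := by
  obtain ⟨A, B, hAB, hQ⟩ := Finset.card_eq_two.1 (hreg i).1
  obtain ⟨g, hg, rfl⟩ := exists_aux_of_mem_Qset hcnf hreg (i := i) (C := A) (by simp [hQ])
  obtain ⟨h, hh, rfl⟩ := exists_aux_of_mem_Qset hcnf hreg (i := i) (C := B) (by simp [hQ])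
  exact ⟨g, h, hg, hh, fun hgh => hAB (by rw [hgh]), hQ⟩

open Classical in
/-- The auxiliary literals falsified by unit propagation from `φ ∧ x_i`. -/
noncomputable def falsified (φ : CNF (Var n ℓ)) (i : Fin n) : Finset (Lit (Var n ℓ)) :=
  Finset.univ.filter fun l =>
    l.1.isRight = true ∧ UnitDerives (addUnit φ (inLit i true)) {negLit l}

theorem mem_falsified {i : Fin n} {l : Lit (Var n ℓ)} : l ∈ falsified φ i ↔
    l.1.isRight = true ∧ UnitDerives (addUnit φ (inLit i true)) {negLit l} := by
  simp [falsified]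

theorem exists_cnfSat_addUnit (hpe : IsPEncoding φ) (i : Fin n) :
    ∃ α, CnfSat α (addUnit φ (inLit i true)) := by
  obtain ⟨α, hα, hi⟩ := hpe.2.1 i
  refine ⟨α, fun C hC => ?_⟩
  rcases Finset.mem_insert.1 hC with rfl | hC
  · exact ⟨_, Finset.mem_singleton_self _, hi⟩
  · exact hα C hC

theorem not_unitDerives_negLit (hpe : IsPEncoding φ) {i : Fin n} {l : Lit (Var n ℓ)}
    (h : UnitDerives (addUnit φ (inLit i true)) {l}) :
    ¬ UnitDerives (addUnit φ (inLit i true)) {negLit l} := by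
  obtain ⟨α, hα⟩ := exists_cnfSat_addUnit hpe i
  exact fun h' => litSat_negLit.1 (h'.litSat hα) (h.litSat hα)

theorem card_falsified_le (hpe : IsPEncoding φ) (hreg : RegularForm φ) (i : Fin n) :
    (falsified φ i).card ≤ (coreClauses φ).card + 2 := by
  have hreason : ∀ l : Lit (Var n ℓ), ∃ B : Clause (Var n ℓ), l ∈ falsified φ i →
      B ∈ coreClauses φ ∪ Qset φ i ∧ negLit l ∈ B ∧
      ∀ m ∈ B, m ≠ negLit l → UnitDerives (addUnit φ (inLit i true)) {negLit m} := by
    intro l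
    by_cases hl : l ∈ falsified φ i
    · obtain ⟨haux, hd⟩ := mem_falsified.1 hl
      obtain ⟨B, hB, hlB, hrest⟩ := hd.exists_reason
      refine ⟨B, fun _ => ⟨?_, hlB, hrest⟩⟩
      have hinput : ∀ (j : Fin n) (b : Bool), inLit j b ≠ negLit l := by
        intro j b h
        have : (Sum.inl j : Var n ℓ) = l.1 := congrArg Prod.fst h
        simp [← this] at haux
      rcases Finset.mem_insert.1 hB with rfl | hBφ
      · exact absurd (Finset.mem_singleton.1 hlB).symm (hinput i true)
      · rw [Finset.mem_union]
        by_cases hneg : ∃ j : Fin n, inLit j false ∈ B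
        · obtain ⟨j, hj⟩ := hneg
          by_cases hij : i = j
          · subst hij
            exact Or.inr (Finset.mem_filter.2 ⟨hBφ, hj⟩)
          · exact absurd (hrest _ hj (hinput j false))
              (not_unitDerives_negLit hpe (hpe.2.2 i j hij))
        · push Not at hneg
          exact Or.inl (Finset.mem_filter.2 ⟨hBφ, hneg⟩)
    · exact ⟨∅, fun h => absurd h hl⟩
  choose f hf using hreason
  calc (falsified φ i).card ≤ (coreClauses φ ∪ Qset φ i).card := by
        refine Finset.card_le_card_of_injOn f (fun l hl => (hf l hl).1) ?_
        intro l hl m hm hlm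
        by_contra hne
        refine not_unitDerives_negLit hpe (mem_falsified.1 hm).2 ?_
        refine (hf l hl).2.2 _ (hlm ▸ (hf m hm).2.1) fun h => hne ?_
        exact (negLit_involutive.injective h).symm
    _ ≤ (coreClauses φ).card + (Qset φ i).card := Finset.card_union_le _ _
    _ = (coreClauses φ).card + 2 := by rw [(hreg i).1]

theorem negLit_mem_falsified {i : Fin n} {g : Lit (Var n ℓ)} (hg : g.1.isRight = true)
    (hC : ({inLit i false, g} : Clause (Var n ℓ)) ∈ φ) : negLit g ∈ falsified φ i := by
  have hne : inLit i false ≠ g := by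
    rintro rfl
    simp [inLit] at hg
  refine mem_falsified.2 ⟨hg, ?_⟩
  rw [negLit_involutive]
  have hx : UnitDerives (addUnit φ (inLit i true)) {inLit i true} :=
    .base (Finset.mem_insert_self _ _)
  have hstep := hx.step (.base (Finset.mem_insert_of_mem hC))
    (Finset.mem_insert_self (inLit i false) {g})
  rwa [show negLit (inLit i true : Lit (Var n ℓ)) = inLit i false from rfl,
    Finset.erase_insert (by simpa using hne)] at hstep

theorem mem_falsified_or_of_ne (hpe : IsPEncoding φ) {i j : Fin n} (hij : i ≠ j)
    {g h : Lit (Var n ℓ)} (hg : g.1.isRight = true) (hh : h.1.isRight = true)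
    (hQ : Qset φ j = {{inLit j false, g}, {inLit j false, h}}) :
    g ∈ falsified φ i ∨ h ∈ falsified φ i := by
  obtain ⟨B, hB, hjB, hrest⟩ := (hpe.2.2 i j hij).exists_reason
  have hne : ∀ l : Lit (Var n ℓ), l.1.isRight = true → l ≠ inLit j false := by
    rintro l hl rfl
    simp [inLit] at hl
  rcases Finset.mem_insert.1 hB with rfl | hBφ
  · have := congrArg Prod.snd (Finset.mem_singleton.1 hjB)
    simp [inLit] at this
  · have hBQ : B ∈ Qset φ j := Finset.mem_filter.2 ⟨hBφ, hjB⟩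
    rw [hQ, Finset.mem_insert, Finset.mem_singleton] at hBQ
    rcases hBQ with rfl | rfl
    · exact Or.inl (mem_falsified.2 ⟨hg, hrest g (by simp) (hne g hg)⟩)
    · exact Or.inr (mem_falsified.2 ⟨hh, hrest h (by simp) (hne h hh)⟩)

theorem le_of_regularForm (hpe : IsPEncoding φ) (hreg : RegularForm φ) :
    n ≤ ((coreClauses φ).card + 2) * max 2 ((coreClauses φ).card + 1) + 1 := by
  choose g h hg hh hne hQ using exists_aux_pair hpe.1 hreg
  have hQφ : ∀ i, Qset φ i ⊆ φ := fun i => Finset.filter_subset _ _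
  have := card_pairs_le (neg := negLit) (D := falsified φ) negLit_involutive
    (card_falsified_le hpe hreg)
    (fun i z hz hz' => not_unitDerives_negLit hpe (mem_falsified.1 hz).2 (mem_falsified.1 hz').2)
    (fun i => negLit_mem_falsified (hg i) (hQφ i (by simp [hQ])))
    (fun i => negLit_mem_falsified (hh i) (hQφ i (by simp [hQ])))
    (fun i j hij => mem_falsified_or_of_ne hpe hij (hg j) (hh j) (hQ j)) hne
  simpa using this

end Regular

/-- Let φ be a p-encoding with n ≥ 7 input variables in regular form.
Then |φ| ≥ 2n + √(n − 3/4) − 3/2. -/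
theorem regular_form_lower_bound (n ℓ : ℕ) (hn : 7 ≤ n) (φ : CNF (Var n ℓ))
    (hpe : IsPEncoding φ) (hreg : RegularForm φ) :
    (2 * (n : ℝ) + Real.sqrt ((n : ℝ) - 3 / 4) - 3 / 2) ≤ (φ.card : ℝ) := by
  rw [card_eq_of_regularForm hreg]
  have hle := le_of_regularForm hpe hreg
  generalize (coreClauses φ).card = r at hle ⊢
  have hr : 1 ≤ r := by
    by_contra! h
    obtain rfl : r = 0 := by omega
    norm_num at hle
    omega
  rw [max_eq_right (by omega)] at hle
  have hle' : (n : ℝ) ≤ (r + 2) * (r + 1) + 1 := by exact_mod_cast hle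
  have hsqrt : Real.sqrt ((n : ℝ) - 3 / 4) ≤ r + 3 / 2 :=
    Real.sqrt_le_iff.2 ⟨by positivity, by nlinarith⟩
  push_cast
  linarith
end
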